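/- Let G be a countable group, let A and B be finite alphabets, let Y ⊆ A^G and Z ⊆ B^G be subshifts, and let π : Y → Z be a continuous, shift-commuting surjection (π(σ^g y) = σ^g(π(y)) for all y ∈ Y, g ∈ G). If Y is strongly irreducible witnessed by some finite set K ⊆ G with e ∈ K, then Z is strongly irreducible, i.e. there exists a finite set K' ⊆ G with e ∈ K' witnessing Z as strongly irreducible. -/

import Mathlib

open Pointwise

/-- The shift action of a group `G` on `G → A`: `σ^g(x)(h) = x(hg)`. -/
def shiftMap {G A : Type*} [Group G] (g : G) (x : G → A) : G → A := fun h => x (h * g)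

/-- A subshift: a closed, shift-invariant subset of the full shift `A^G`. -/
def IsSubshift {G A : Type*} [Group G] [TopologicalSpace A] (X : Set (G → A)) : Prop :=
  IsClosed X ∧ ∀ g : G, shiftMap g '' X = X

/-- `P(F, X)`: the set of patterns of shape `F` appearing in points of `X`,
i.e. the restrictions of points of `X` to `F`. -/
def patterns {G A : Type*} [Group G] (F : Finset G) (X : Set (G → A)) : Set (F → A) :=
  (fun x => fun f : F => x ↑f) '' X

/-- `Y` is strongly irreducible witnessed by the finite set `K ∋ e`: any two allowed patterns
on finite sets `F₁, F₂` with `KF₁ ∩ F₂ = ∅` appear jointly in a single point of `Y`. -/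
def IsStronglyIrreducibleWitnessedBy {G A : Type*} [Group G] [DecidableEq G]
    (Y : Set (G → A)) (K : Finset G) : Prop :=
  (1 : G) ∈ K ∧
    ∀ F₁ F₂ : Finset G, Disjoint (K * F₁) F₂ →
      ∀ p₁ ∈ patterns F₁ Y, ∀ p₂ ∈ patterns F₂ Y,
        ∃ y ∈ Y, (fun f : F₁ => y ↑f) = p₁ ∧ (fun f : F₂ => y ↑f) = p₂

/-- A continuous map from a compact set of configurations to a discrete space depends, uniformly
on that set, on finitely many coordinates only. -/
theorem exists_finset_determining {G A B : Type*} [DecidableEq G]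
    [TopologicalSpace A] [DiscreteTopology A] [TopologicalSpace B] [DiscreteTopology B]
    {Y : Set (G → A)} (hY : IsCompact Y) {f : (G → A) → B} (hf : ContinuousOn f Y) :
    ∃ D : Finset G, ∀ y ∈ Y, ∀ y' ∈ Y, (∀ d ∈ D, y d = y' d) → f y = f y' := by
  suffices h : ∃ D : Finset G, ∀ y ∈ Y, y ∈ Y → ∀ y' ∈ Y, (∀ d ∈ D, y d = y' d) → f y = f y' by
    obtain ⟨D, hD⟩ := h
    exact ⟨D, fun y hy => hD y hy hy⟩
  refine hY.induction_on
    (p := fun s => ∃ D : Finset G, ∀ y ∈ s, y ∈ Y → ∀ y' ∈ Y, (∀ d ∈ D, y d = y' d) → f y = f y')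
    ⟨∅, by simp⟩ ?_ ?_ ?_
  · rintro s t hst ⟨D, hD⟩
    exact ⟨D, fun y hy => hD y (hst hy)⟩
  · rintro s t ⟨D, hD⟩ ⟨E, hE⟩
    refine ⟨D ∪ E, ?_⟩
    rintro y (hy | hy) hyY y' hy' h
    · exact hD y hy hyY y' hy' fun d hd => h d (Finset.mem_union_left _ hd)
    · exact hE y hy hyY y' hy' fun d hd => h d (Finset.mem_union_right _ hd)
  · intro y hy
    have hnhds : f ⁻¹' {f y} ∈ nhdsWithin y Y :=
      hf y hy ((isOpen_discrete {f y}).mem_nhds rfl)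
    obtain ⟨U, hU, hyU, hUf⟩ := mem_nhdsWithin.1 hnhds
    obtain ⟨D, u, hu, huU⟩ := isOpen_pi_iff.1 hU y hyU
    refine ⟨(D : Set G).pi u, mem_nhdsWithin_of_mem_nhds
      (set_pi_mem_nhds D.finite_toSet fun d hd => (hu d hd).1.mem_nhds (hu d hd).2), D, ?_⟩
    intro x hx hxY x' hx' h
    have hx'u : x' ∈ (D : Set G).pi u := fun d hd => h d hd ▸ hx d hd
    have e₁ : f x = f y := hUf ⟨huU hx, hxY⟩
    have e₂ : f x' = f y := hUf ⟨huU hx'u, hx'⟩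
    exact e₁.trans e₂.symm

/-- Strong irreducibility is preserved under factor maps: if `π : Y → Z` is a
continuous, shift-commuting surjection between subshifts and `Y` is strongly irreducible, then
so is `Z`. -/
theorem strongly_irreducible_factor {G A B : Type*} [Group G] [Countable G] [DecidableEq G]
    [Fintype A] [Nonempty A] [TopologicalSpace A] [DiscreteTopology A]
    [Fintype B] [Nonempty B] [TopologicalSpace B] [DiscreteTopology B]
    (Y : Set (G → A)) (Z : Set (G → B)) (hY : IsSubshift Y) (hZ : IsSubshift Z)
    (π : (G → A) → (G → B)) (hcont : ContinuousOn π Y)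
    (hcomm : ∀ y ∈ Y, ∀ g : G, π (shiftMap g y) = shiftMap g (π y))
    (hsurj : π '' Y = Z)
    (K : Finset G) (hSI : IsStronglyIrreducibleWitnessedBy Y K) :
    ∃ K' : Finset G, IsStronglyIrreducibleWitnessedBy Z K' := by
  obtain ⟨D, hD⟩ := exists_finset_determining (f := fun y => π y 1) hY.1.isCompact
    ((continuous_apply (1 : G)).comp_continuousOn hcont)
  have shift_mem : ∀ y ∈ Y, ∀ g : G, shiftMap g y ∈ Y := fun y hy g =>
    hY.2 g ▸ Set.mem_image_of_mem _ hy
  have local_rule : ∀ F : Finset G, ∀ y ∈ Y, ∀ y' ∈ Y,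
      (fun f : (D * F : Finset G) => y ↑f) = (fun f : (D * F : Finset G) => y' ↑f) →
      (fun f : F => π y ↑f) = (fun f : F => π y' ↑f) := by
    intro F y hy y' hy' h
    funext ⟨g, hg⟩
    have key := hD _ (shift_mem y hy g) _ (shift_mem y' hy' g)
      fun d hd => congrFun h ⟨d * g, Finset.mul_mem_mul hd hg⟩
    simpa [hcomm y hy, hcomm y' hy', shiftMap] using key
  refine ⟨insert 1 (D⁻¹ * K * D), Finset.mem_insert_self _ _, ?_⟩
  subst hsurj
  rintro F₁ F₂ hdisj _ ⟨_, ⟨y₁, hy₁, rfl⟩, rfl⟩ _ ⟨_, ⟨y₂, hy₂, rfl⟩, rfl⟩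
  have hdisj' : Disjoint (K * (D * F₁)) (D * F₂) := by
    rw [Finset.disjoint_left] at hdisj ⊢
    intro x hx₁ hx₂
    obtain ⟨d, hd, g, hg, rfl⟩ := Finset.mem_mul.1 hx₂
    refine hdisj (a := g) ?_ hg
    have hmem : d⁻¹ * (d * g) ∈ D⁻¹ * (K * (D * F₁)) :=
      Finset.mul_mem_mul (Finset.inv_mem_inv hd) hx₁
    rw [inv_mul_cancel_left, ← mul_assoc, ← mul_assoc] at hmem
    exact Finset.mul_subset_mul_right (Finset.subset_insert _ _) hmem
  obtain ⟨y, hy, h₁, h₂⟩ := hSI.2 _ _ hdisj' _ ⟨y₁, hy₁, rfl⟩ _ ⟨y₂, hy₂, rfl⟩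
  exact ⟨π y, ⟨y, hy, rfl⟩, local_rule F₁ y hy y₁ hy₁ h₁, local_rule F₂ y hy y₂ hy₂ h₂⟩
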